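/- For each n ≥ 1 let p_n be a probability distribution on the positive integers and X_n a random variable with distribution p_n, with E[log X_n] > 0 (possibly infinite). Suppose there is a sequence (a_n) of positive reals with a_n → ∞ and a_n = O(log n) such that, setting Y_n = (log X_n)·1{log X_n ≤ a_n} and Z_n = Y_n + a_n·1{log X_n > a_n}, one has lim_{n→∞} (log n)·E[Z_n²]/(a_n²·E[Y_n]) = 0 and lim_{n→∞} (log n)/E[Y_n] = ∞. Set t_n = (3·log n)/(2·E[Y_n]). Then for every ε ∈ (0,1): for every sequence of integers (k_n) with k_n > (1+ε)·t_n for all n, lim_{n→∞} ‖Q_{n,p_n}^{k_n} − U_n‖_TV = 0; and for every sequence of nonnegative integers (k_n) with k_n < (1−ε)·t_n for all n, lim_{n→∞} ‖Q_{n,p_n}^{k_n} − U_n‖_TV = 1. -/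

import Mathlib

open Filter MeasureTheory
open scoped BigOperators NNReal ENNReal

noncomputable section

/-- The value of `σ⁻¹` at position `i` (0-indexed), as a natural number; `0` out of range. -/
def invAt (n : ℕ) (σ : Equiv.Perm (Fin n)) (i : ℕ) : ℕ :=
  if h : i < n then ((σ⁻¹ ⟨i, h⟩ : Fin n) : ℕ) else 0

/-- The number of rising sequences of a permutation: one plus the number of descents
of its inverse. -/
def rSeq (n : ℕ) (σ : Equiv.Perm (Fin n)) : ℕ :=
  1 + ((Finset.range (n - 1)).filter fun i => invAt n σ (i + 1) < invAt n σ i).card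

/-- The `m`-shuffle distribution on `S_n`:  `Q_{n,m}(σ) = m^{-n} C(n + m - r(σ), n)`. -/
def Qs (n m : ℕ) (σ : Equiv.Perm (Fin n)) : ℝ :=
  ((m : ℝ) ^ n)⁻¹ * (Nat.choose (n + m - rSeq n σ) n : ℝ)

/-- The uniform distribution on `S_n`. -/
def Us (n : ℕ) (_ : Equiv.Perm (Fin n)) : ℝ := (n.factorial : ℝ)⁻¹

/-- Total variation distance between two probability distributions on `S_n`. -/
def tv (n : ℕ) (μ ν : Equiv.Perm (Fin n) → ℝ) : ℝ :=
  (1 / 2) * ∑ σ : Equiv.Perm (Fin n), |μ σ - ν σ|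

/-- Convolution of two distributions on `S_n`. -/
def convol (n : ℕ) (μ ν : Equiv.Perm (Fin n) → ℝ) : Equiv.Perm (Fin n) → ℝ :=
  fun σ => ∑ τ : Equiv.Perm (Fin n), μ (σ * τ⁻¹) * ν τ

/-- `k`-fold convolution power; the `0`-th power is the point mass at the identity. -/
def iterConv (n : ℕ) (μ : Equiv.Perm (Fin n) → ℝ) : ℕ → Equiv.Perm (Fin n) → ℝ
  | 0 => fun σ => if σ = 1 then 1 else 0
  | k + 1 => convol n μ (iterConv n μ k)

/-- `Ψ(x) = (2π)^{-1/2} ∫_{-x/(4√3)}^{x/(4√3)} e^{-t²/2} dt`. -/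
def Psi (x : ℝ) : ℝ :=
  (Real.sqrt (2 * Real.pi))⁻¹ *
    ∫ t in (-(x / (4 * Real.sqrt 3)))..(x / (4 * Real.sqrt 3)), Real.exp (-t ^ 2 / 2)

/-- The `p`-shuffle distribution on `S_n` for a probability `p` on the positive integers. -/
def Qp (n : ℕ) (p : ℕ → ℝ) (σ : Equiv.Perm (Fin n)) : ℝ := ∑' m : ℕ, p m * Qs n m σ

theorem card_strictMono_fin (n N : ℕ) :
    Nat.card {g : Fin n → Fin N // StrictMono g} = N.choose n := by
  rw [Nat.card_congr (?_ : {g : Fin n → Fin N // StrictMono g} ≃ Set.powersetCard (Fin N) n)]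
  · rw [Set.powersetCard.card, Nat.card_fin]
  · exact Equiv.trans
      { toFun := fun g => OrderEmbedding.ofStrictMono g.1 g.2
        invFun := fun g => ⟨g, g.strictMono⟩
        left_inv := fun _ => rfl
        right_inv := fun _ => rfl } Set.powersetCard.ofFinEmbEquiv

/-- Number of positions before `i` at which `P` fails. -/
def failCount (P : ℕ → Prop) [DecidablePred P] (i : ℕ) : ℕ :=
  ((Finset.range i).filter fun j => ¬ P j).card

theorem failCount_succ (P : ℕ → Prop) [DecidablePred P] (i : ℕ) :
    failCount P (i + 1) = failCount P i + if P i then 0 else 1 := by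
  unfold failCount
  rw [Finset.range_add_one, Finset.filter_insert]
  by_cases h : P i
  · simp [h]
  · simp [h]

theorem failCount_le (P : ℕ → Prop) [DecidablePred P] (i : ℕ) : failCount P i ≤ i := by
  simpa [failCount] using Finset.card_filter_le (Finset.range i) fun j => ¬ P j

/-- Weakly increasing sequences in `Fin m` that increase strictly where `P` holds become
strictly increasing sequences after adding the number of earlier non-strict steps. -/
theorem card_monotone_strict_at (k m : ℕ) (P : ℕ → Prop) [DecidablePred P] :
    Nat.card {s : Fin (k + 1) → Fin m //
      ∀ i : Fin k, s i.castSucc ≤ s i.succ ∧ (P i → s i.castSucc < s i.succ)} =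
      (m + failCount P k).choose (k + 1) := by
  rw [← card_strictMono_fin]
  have up : ∀ s : Fin (k + 1) → Fin m,
      (∀ i : Fin k, s i.castSucc ≤ s i.succ ∧ (P i → s i.castSucc < s i.succ)) →
      StrictMono fun i => (s i : ℕ) + failCount P i := by
    intro s hs
    rw [Fin.strictMono_iff_lt_succ]
    intro i
    have h1 : (s i.castSucc : ℕ) ≤ s i.succ := (hs i).1
    have h2 : P i → (s i.castSucc : ℕ) < s i.succ := (hs i).2
    simp only [Fin.val_castSucc, Fin.val_succ, failCount_succ]
    split_ifs with h
    · have := h2 h; omega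
    · omega
  have fc_mono : Monotone (failCount P) := monotone_nat_of_le_succ fun i => by
    rw [failCount_succ]; omega
  have low : ∀ g : Fin (k + 1) → Fin (m + failCount P k), StrictMono g →
      ∀ i : Fin (k + 1), (i : ℕ) ≤ g i := by
    intro g hg i
    induction i using Fin.induction with
    | zero => simp
    | succ i ih =>
      have : (g i.castSucc : ℕ) < g i.succ := hg i.castSucc_lt_succ
      simp only [Fin.val_castSucc] at ih
      simp only [Fin.val_succ]; omega
  have lowf : ∀ g : Fin (k + 1) → Fin (m + failCount P k), StrictMono g →
      ∀ i : Fin (k + 1), failCount P i ≤ g i := fun g hg i => (failCount_le P i).trans (low g hg i)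
  have dn : ∀ g : Fin (k + 1) → Fin (m + failCount P k), StrictMono g → ∀ i : Fin k,
      (g i.castSucc : ℕ) - failCount P i ≤ g i.succ - failCount P (i + 1) ∧
        (P i → (g i.castSucc : ℕ) - failCount P i < g i.succ - failCount P (i + 1)) := by
    intro g hg i
    have h1 : (g i.castSucc : ℕ) < g i.succ := hg i.castSucc_lt_succ
    have h2 := lowf g hg i.castSucc
    have h3 := lowf g hg i.succ
    simp only [Fin.val_castSucc, Fin.val_succ] at h2 h3
    rw [failCount_succ] at h3 ⊢
    split_ifs at h3 ⊢ with h
    · exact ⟨by omega, fun _ => by omega⟩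
    · exact ⟨by omega, fun h' => absurd h' h⟩
  have dnm : ∀ g : Fin (k + 1) → Fin (m + failCount P k), StrictMono g →
      ∀ i : Fin (k + 1), (g i : ℕ) - failCount P i < m := by
    intro g hg i
    have hmono : Monotone fun i : Fin (k + 1) => (g i : ℕ) - failCount P i :=
      Fin.monotone_iff_le_succ.2 fun i => by
        simpa using (dn g hg i).1
    have h1 := hmono (Fin.le_last i)
    have h2 := lowf g hg (Fin.last k)
    have h3 := (g (Fin.last k)).2
    simp only [Fin.val_last] at h1 h2 h3
    omega
  refine Nat.card_congr
    { toFun := fun s => ⟨fun i => ⟨s.1 i + failCount P i, ?_⟩, ?_⟩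
      invFun := fun g => ⟨fun i => ⟨(g.1 i : ℕ) - failCount P i, dnm g.1 g.2 i⟩, ?_⟩
      left_inv := ?_
      right_inv := ?_ }
  · exact add_lt_add_of_lt_of_le (s.1 i).2 (fc_mono (Nat.lt_succ_iff.1 i.2))
  · exact fun i j hij => up s.1 s.2 hij
  · intro i
    have := dn g.1 g.2 i
    exact ⟨by simpa [Fin.le_def] using this.1, fun h => by simpa [Fin.lt_def] using this.2 h⟩
  · intro s
    ext i
    simp
  · intro g
    ext i
    simpa using Nat.sub_add_cancel (lowf g.1 g.2 i)

theorem sort_eq_iff_succ {α : Type*} [LinearOrder α] {k : ℕ} (f : Fin (k + 1) → α)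
    (π : Equiv.Perm (Fin (k + 1))) :
    Tuple.sort f = π ↔ ∀ i : Fin k, f (π i.castSucc) ≤ f (π i.succ) ∧
      (π i.succ < π i.castSucc → f (π i.castSucc) < f (π i.succ)) := by
  rw [eq_comm, Tuple.eq_sort_iff', Fin.strictMono_iff_lt_succ]
  refine forall_congr' fun i => ?_
  have hne : π i.castSucc ≠ π i.succ := π.injective.ne i.castSucc_lt_succ.ne
  have : ((π.trans (Tuple.graphEquiv₁ f)) i.castSucc < (π.trans (Tuple.graphEquiv₁ f)) i.succ) ↔
      toLex (f (π i.castSucc), π i.castSucc) < toLex (f (π i.succ), π i.succ) := Iff.rfl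
  rw [this, Prod.Lex.toLex_lt_toLex]
  constructor
  · rintro (h | ⟨h, h'⟩)
    · exact ⟨h.le, fun _ => h⟩
    · exact ⟨h.le, fun h'' => absurd h'' h'.asymm⟩
  · rintro ⟨h1, h2⟩
    rcases h1.lt_or_eq with h | h
    · exact Or.inl h
    · refine Or.inr ⟨h, lt_of_le_of_ne (not_lt.1 fun h3 => (h2 h3).ne h) hne⟩

theorem rSeq_eq (k : ℕ) (σ : Equiv.Perm (Fin (k + 1))) :
    rSeq (k + 1) σ + failCount (fun i => invAt (k + 1) σ (i + 1) < invAt (k + 1) σ i) k =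
      k + 1 := by
  unfold rSeq failCount
  have := Finset.card_filter_add_card_filter_not (s := Finset.range k)
    (fun i => invAt (k + 1) σ (i + 1) < invAt (k + 1) σ i)
  simp only [Finset.card_range] at this
  simp only [Nat.add_sub_cancel]
  omega

theorem card_sort_eq (n m : ℕ) (σ : Equiv.Perm (Fin n)) :
    Nat.card {f : Fin n → Fin m // Tuple.sort f = σ⁻¹} = (n + m - rSeq n σ).choose n := by
  cases n with
  | zero =>
    rw [Nat.choose_zero_right, Nat.card_eq_one_iff_unique]
    exact ⟨inferInstance, ⟨⟨Fin.elim0, Subsingleton.elim _ _⟩⟩⟩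
  | succ k =>
    have hr := rSeq_eq k σ
    rw [show k + 1 + m - rSeq (k + 1) σ = m + failCount
      (fun i => invAt (k + 1) σ (i + 1) < invAt (k + 1) σ i) k by omega,
      ← card_monotone_strict_at]
    refine Nat.card_congr ((Equiv.arrowCongr σ (Equiv.refl _)).subtypeEquiv fun f => ?_)
    rw [sort_eq_iff_succ]
    refine forall_congr' fun i => ?_
    have h1 : invAt (k + 1) σ i = (σ⁻¹ i.castSucc : Fin (k + 1)) := by
      unfold invAt; rw [dif_pos (by omega)]; rfl
    have h2 : invAt (k + 1) σ (i + 1) = (σ⁻¹ i.succ : Fin (k + 1)) := by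
      unfold invAt; rw [dif_pos (by omega)]; rfl
    rw [h1, h2]
    rfl

/-- The number of words on the alphabet `α` whose stable sorting permutation is `π`. -/
def sortCount (n : ℕ) (α : Type*) [LinearOrder α] [Fintype α] (π : Equiv.Perm (Fin n)) : ℕ :=
  ((Finset.univ : Finset (Fin n → α)).filter fun f => Tuple.sort f = π).card

theorem sort_strictMono_comp {α β : Type*} [LinearOrder α] [LinearOrder β] {n : ℕ}
    (f : Fin n → α) {e : α → β} (he : StrictMono e) : Tuple.sort (e ∘ f) = Tuple.sort f := by
  symm
  rw [Tuple.eq_sort_iff]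
  have h := Tuple.eq_sort_iff.1 (rfl : Tuple.sort f = Tuple.sort f)
  exact ⟨he.monotone.comp h.1, fun i j hij hf => h.2 i j hij (he.injective hf)⟩

theorem sortCount_congr {α β : Type*} [LinearOrder α] [Fintype α] [LinearOrder β] [Fintype β]
    (n : ℕ) (e : α ≃o β) (π : Equiv.Perm (Fin n)) : sortCount n α π = sortCount n β π := by
  unfold sortCount
  refine Finset.card_equiv (Equiv.arrowCongr (Equiv.refl _) e.toEquiv) fun f => ?_
  simp only [Finset.mem_filter, Finset.mem_univ, true_and]
  rw [show (Equiv.arrowCongr (Equiv.refl (Fin n)) e.toEquiv) f = e ∘ f from rfl,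
    sort_strictMono_comp f e.strictMono]

theorem sort_lex {α β : Type*} [LinearOrder α] [LinearOrder β] {n : ℕ}
    (f : Fin n → α) (g : Fin n → β) :
    Tuple.sort (fun x => toLex (f ((Tuple.sort g)⁻¹ x), g x)) = Tuple.sort g * Tuple.sort f := by
  symm
  have hf := Tuple.eq_sort_iff.1 (rfl : Tuple.sort f = Tuple.sort f)
  have hg := Tuple.eq_sort_iff.1 (rfl : Tuple.sort g = Tuple.sort g)
  have hinv : ∀ x, (Tuple.sort g)⁻¹ (Tuple.sort g x) = x := (Tuple.sort g).symm_apply_apply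
  rw [Tuple.eq_sort_iff]
  simp only [Function.comp_def, Equiv.Perm.coe_mul, hinv, EmbeddingLike.apply_eq_iff_eq, Prod.mk.injEq]
  constructor
  · intro i j hij
    simp only [Prod.Lex.toLex_le_toLex]
    rcases hij.eq_or_lt with rfl | hij
    · exact Or.inr ⟨rfl, le_rfl⟩
    rcases (hf.1 hij.le).lt_or_eq with h | h
    · exact Or.inl h
    · exact Or.inr ⟨h, hg.1 (hf.2 i j hij h).le⟩
  · rintro i j hij ⟨h1, h2⟩
    exact hg.2 _ _ (hf.2 i j hij h1) h2

/-- Pairs of words correspond to words over the lexicographic product alphabet, the first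
word being read in the order that sorts the second. -/
def lexWordEquiv (n : ℕ) (α β : Type*) [LinearOrder α] [LinearOrder β] :
    (Fin n → α) × (Fin n → β) ≃ (Fin n → α ×ₗ β) where
  toFun p := fun x => toLex (p.1 ((Tuple.sort p.2)⁻¹ x), p.2 x)
  invFun h := (fun x => (ofLex (h (Tuple.sort (fun y => (ofLex (h y)).2) x))).1,
    fun y => (ofLex (h y)).2)
  left_inv p := by simp
  right_inv h := by simp

theorem sortCount_lex {α β : Type*} [LinearOrder α] [Fintype α] [LinearOrder β] [Fintype β]
    (n : ℕ) (π : Equiv.Perm (Fin n)) :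
    sortCount n (α ×ₗ β) π = ∑ ρ, sortCount n β ρ * sortCount n α (ρ⁻¹ * π) := by
  classical
  have h1 : sortCount n (α ×ₗ β) π = ((Finset.univ : Finset ((Fin n → α) × (Fin n → β))).filter
      fun p => Tuple.sort p.2 * Tuple.sort p.1 = π).card := by
    unfold sortCount
    refine (Finset.card_equiv (lexWordEquiv n α β) fun p => ?_).symm
    simp only [Finset.mem_filter, Finset.mem_univ, true_and]
    rw [← sort_lex]
    rfl
  rw [h1, Finset.card_eq_sum_card_fiberwise (f := fun p => Tuple.sort p.2)
    (t := Finset.univ) (fun _ _ => Finset.mem_coe.2 (Finset.mem_univ _))]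
  refine Finset.sum_congr rfl fun ρ _ => ?_
  unfold sortCount
  rw [mul_comm, ← Finset.card_product]
  congr 1
  ext ⟨f, g⟩
  simp only [Finset.mem_filter, Finset.mem_univ, true_and, Finset.mem_product]
  constructor
  · rintro ⟨h, rfl⟩
    exact ⟨by rw [← h]; group, rfl⟩
  · rintro ⟨h, rfl⟩
    exact ⟨by rw [h]; group, rfl⟩

theorem sum_sortCount (n : ℕ) (α : Type*) [LinearOrder α] [Fintype α] :
    ∑ π, sortCount n α π = Fintype.card α ^ n := by
  classical
  unfold sortCount
  rw [← Finset.card_eq_sum_card_fiberwise (fun _ _ => Finset.mem_coe.2 (Finset.mem_univ _))]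
  simp

theorem Qs_eq (n m : ℕ) (σ : Equiv.Perm (Fin n)) :
    Qs n m σ = ((m : ℝ) ^ n)⁻¹ * (sortCount n (Fin m) σ⁻¹ : ℝ) := by
  rw [Qs, ← card_sort_eq, sortCount, Nat.card_eq_fintype_card, Fintype.card_subtype]

theorem Qs_nonneg (n m : ℕ) (σ : Equiv.Perm (Fin n)) : 0 ≤ Qs n m σ := by
  unfold Qs; positivity

theorem sum_Qs (n m : ℕ) (hm : m ≠ 0) : ∑ σ, Qs n m σ = 1 := by
  simp only [Qs_eq, ← Finset.mul_sum]
  rw [← Nat.cast_sum, show ∑ σ : Equiv.Perm (Fin n), sortCount n (Fin m) σ⁻¹ = _ from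
    Equiv.sum_comp (Equiv.inv _) (sortCount n (Fin m)), sum_sortCount]
  have : (m : ℝ) ≠ 0 := by exact_mod_cast hm
  simp [this]

theorem Qs_zero (n : ℕ) (hn : n ≠ 0) (σ : Equiv.Perm (Fin n)) : Qs n 0 σ = 0 := by
  simp [Qs, hn]

theorem sum_Qs_le (n m : ℕ) : ∑ σ, Qs n m σ ≤ 1 := by
  rcases eq_or_ne m 0 with rfl | hm
  · rcases eq_or_ne n 0 with rfl | hn
    · simp [Qs]
    · simp [Qs_zero n hn]
  · exact (sum_Qs n m hm).le

theorem Qs_le_one (n m : ℕ) (σ : Equiv.Perm (Fin n)) : Qs n m σ ≤ 1 :=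
  (Finset.single_le_sum (fun τ _ => Qs_nonneg n m τ) (Finset.mem_univ σ)).trans (sum_Qs_le n m)

theorem convol_Qs (n a b : ℕ) (σ : Equiv.Perm (Fin n)) :
    convol n (Qs n a) (Qs n b) σ = Qs n (a * b) σ := by
  have e : Fin (a * b) ≃o Fin a ×ₗ Fin b :=
    Fintype.orderIsoFinOfCardEq _ (by
      rw [Fintype.card_congr (ofLex : Fin a ×ₗ Fin b ≃ Fin a × Fin b)]; simp)
  simp only [convol, Qs_eq]
  rw [sortCount_congr n e, sortCount_lex, Nat.cast_mul, mul_pow, mul_inv, Nat.cast_sum,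
    Finset.mul_sum, ← Equiv.sum_comp (Equiv.inv _)]
  refine Finset.sum_congr rfl fun τ _ => ?_
  simp only [Equiv.inv_apply, mul_inv_rev, inv_inv, Nat.cast_mul]
  ring

theorem Qs_one (n : ℕ) (σ : Equiv.Perm (Fin n)) : Qs n 1 σ = if σ = 1 then 1 else 0 := by
  rw [Qs_eq, sortCount]
  have : ∀ f : Fin n → Fin 1, Tuple.sort f = σ⁻¹ ↔ σ = 1 := fun f => by
    have : Tuple.sort f = Equiv.refl _ :=
      Tuple.sort_eq_refl_iff_monotone.2 fun _ _ _ => (Subsingleton.elim _ _).le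
    rw [this, ← Equiv.Perm.one_def, eq_comm, inv_eq_one]
  simp only [this]
  split_ifs with h <;> simp [h]

/-- The deviation of the number of rising sequences below its uniform mean. -/
def riseDev (n : ℕ) (σ : Equiv.Perm (Fin n)) : ℝ := ((n : ℝ) + 1) / 2 - rSeq n σ

/-- The centred indicator that `i` is not a descent of `σ⁻¹`. -/
def stepSign (n : ℕ) (σ : Equiv.Perm (Fin n)) (i : ℕ) : ℝ :=
  if invAt n σ (i + 1) < invAt n σ i then -(1 / 2) else 1 / 2

theorem riseDev_eq_sum (n : ℕ) (hn : n ≠ 0) (σ : Equiv.Perm (Fin n)) :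
    riseDev n σ = ∑ i ∈ Finset.range (n - 1), stepSign n σ i := by
  have h : ∀ i, stepSign n σ i =
      1 / 2 - if invAt n σ (i + 1) < invAt n σ i then (1 : ℝ) else 0 := fun i => by
    unfold stepSign; split_ifs <;> norm_num
  simp only [h, Finset.sum_sub_distrib, Finset.sum_boole, riseDev, rSeq]
  simp [Nat.cast_sub (Nat.one_le_iff_ne_zero.2 hn)]
  ring

theorem invAt_swap_mul (n : ℕ) (σ : Equiv.Perm (Fin n)) (i j : ℕ) (hi : i + 1 < n) :
    invAt n (Equiv.swap ⟨i, by omega⟩ ⟨i + 1, hi⟩ * σ) j =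
      if j = i then invAt n σ (i + 1) else if j = i + 1 then invAt n σ i else invAt n σ j := by
  unfold invAt
  simp only [mul_inv_rev, Equiv.swap_inv, Equiv.Perm.mul_apply]
  split_ifs with h1 h2 h3 h4 h5
  · subst h2; simp
  · subst h3; simp
  all_goals first
    | omega
    | rfl
    | (rw [Equiv.swap_apply_of_ne_of_ne] <;> simpa [Fin.ext_iff])

theorem stepSign_swap_self (n : ℕ) (σ : Equiv.Perm (Fin n)) (i : ℕ) (hi : i + 1 < n) :
    stepSign n (Equiv.swap ⟨i, by omega⟩ ⟨i + 1, hi⟩ * σ) i = - stepSign n σ i := by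
  have hne : invAt n σ i ≠ invAt n σ (i + 1) := by
    unfold invAt
    rw [dif_pos hi, dif_pos (by omega)]
    intro h
    have := σ⁻¹.injective (Fin.ext h)
    simp at this
  unfold stepSign
  rw [invAt_swap_mul, invAt_swap_mul]
  simp only [if_true, Nat.succ_ne_self, if_false]
  split_ifs <;> first | omega | norm_num

theorem stepSign_swap_far (n : ℕ) (σ : Equiv.Perm (Fin n)) (i j : ℕ) (hi : i + 1 < n)
    (hij : i + 1 < j ∨ j + 1 < i) :
    stepSign n (Equiv.swap ⟨i, by omega⟩ ⟨i + 1, hi⟩ * σ) j = stepSign n σ j := by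
  unfold stepSign
  rw [invAt_swap_mul, invAt_swap_mul, if_neg (show j + 1 ≠ i by omega),
    if_neg (show j + 1 ≠ i + 1 by omega), if_neg (show j ≠ i by omega),
    if_neg (show j ≠ i + 1 by omega)]

theorem sum_stepSign_mul_far (n i j : ℕ) (hi : i + 1 < n) (hij : i + 1 < j ∨ j + 1 < i) :
    ∑ σ, stepSign n σ i * stepSign n σ j = 0 := by
  have h := Equiv.sum_comp
    (Equiv.mulLeft (Equiv.swap (⟨i, by omega⟩ : Fin n) ⟨i + 1, hi⟩))
    fun σ => stepSign n σ i * stepSign n σ j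
  simp only [Equiv.coe_mulLeft, stepSign_swap_self, stepSign_swap_far n _ i j hi hij, neg_mul,
    Finset.sum_neg_distrib] at h
  linarith

theorem stepSign_mul_le (n : ℕ) (σ : Equiv.Perm (Fin n)) (i j : ℕ) :
    stepSign n σ i * stepSign n σ j ≤ 1 := by
  unfold stepSign; split_ifs <;> norm_num

theorem sum_riseDev_sq_le (n : ℕ) (hn : n ≠ 0) :
    ∑ σ, riseDev n σ ^ 2 ≤ 3 * n * n.factorial := by
  have h1 : ∑ σ, riseDev n σ ^ 2 = ∑ i ∈ Finset.range (n - 1), ∑ j ∈ Finset.range (n - 1),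
      ∑ σ, stepSign n σ i * stepSign n σ j := by
    simp only [riseDev_eq_sum n hn, sq, Finset.sum_mul_sum]
    rw [Finset.sum_comm]
    exact Finset.sum_congr rfl fun i _ => Finset.sum_comm
  have h2 : ∀ i ∈ Finset.range (n - 1), ∑ j ∈ Finset.range (n - 1),
      ∑ σ, stepSign n σ i * stepSign n σ j ≤ 3 * n.factorial := by
    intro i hi
    rw [Finset.mem_range] at hi
    calc _ ≤ ∑ j ∈ Finset.range (n - 1),
          if j ∈ Finset.Icc (i - 1) (i + 1) then (n.factorial : ℝ) else 0 := by
          refine Finset.sum_le_sum fun j _ => ?_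
          split_ifs with h
          · calc _ ≤ ∑ σ : Equiv.Perm (Fin n), (1 : ℝ) :=
                Finset.sum_le_sum fun σ _ => stepSign_mul_le n σ i j
              _ = n.factorial := by simp [Fintype.card_perm]
          · rw [Finset.mem_Icc] at h
            exact (sum_stepSign_mul_far n i j (by omega) (by omega)).le
      _ = (((Finset.range (n - 1)).filter fun j => j ∈ Finset.Icc (i - 1) (i + 1)).card : ℝ) *
          n.factorial := by
          rw [← Finset.sum_filter, Finset.sum_const, nsmul_eq_mul]
      _ ≤ 3 * n.factorial := by
          gcongr
          have : ((Finset.range (n - 1)).filter fun j => j ∈ Finset.Icc (i - 1) (i + 1)).card ≤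
              (Finset.Icc (i - 1) (i + 1)).card :=
            Finset.card_le_card fun j hj => (Finset.mem_filter.1 hj).2
          rw [Nat.card_Icc] at this
          exact_mod_cast this.trans (by omega)
  rw [h1]
  calc _ ≤ ∑ i ∈ Finset.range (n - 1), 3 * (n.factorial : ℝ) := Finset.sum_le_sum h2
    _ = ((n - 1 : ℕ) : ℝ) * (3 * n.factorial) := by simp
    _ ≤ n * (3 * n.factorial) := by gcongr; omega
    _ = _ := by ring

theorem rSeq_pos (n : ℕ) (σ : Equiv.Perm (Fin n)) : 1 ≤ rSeq n σ := by
  unfold rSeq; omega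

theorem rSeq_le (n : ℕ) (hn : n ≠ 0) (σ : Equiv.Perm (Fin n)) : rSeq n σ ≤ n := by
  obtain ⟨k, rfl⟩ := Nat.exists_eq_succ_of_ne_zero hn
  have := rSeq_eq k σ
  simp only [Nat.succ_eq_add_one]
  omega

/-- The `i`-th relative increment in the product formula for the shuffle density. -/
def shuffleIncr (n m : ℕ) (σ : Equiv.Perm (Fin n)) (i : ℕ) : ℝ :=
  ((n : ℝ) - rSeq n σ - i) / m

theorem factorial_mul_Qs (n m : ℕ) (hm : m ≠ 0) (σ : Equiv.Perm (Fin n)) (hr : rSeq n σ ≤ m) :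
    (n.factorial : ℝ) * Qs n m σ = ∏ i ∈ Finset.range n, (1 + shuffleIncr n m σ i) := by
  have hm' : (m : ℝ) ≠ 0 := by exact_mod_cast hm
  have h1 : (n.factorial : ℝ) * ((n + m - rSeq n σ).choose n : ℝ) =
      ∏ i ∈ Finset.range n, ((m : ℝ) + (n - rSeq n σ - i)) := by
    rw [← Nat.cast_mul, ← Nat.descFactorial_eq_factorial_mul_choose,
      Nat.descFactorial_eq_prod_range, Nat.cast_prod]
    refine Finset.prod_congr rfl fun i hi => ?_
    rw [Finset.mem_range] at hi
    rw [Nat.cast_sub (by omega), Nat.cast_sub (by omega)]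
    push_cast
    ring
  unfold Qs shuffleIncr
  have hpow : (m : ℝ) ^ n = ∏ i ∈ Finset.range n, (m : ℝ) := by simp
  rw [mul_left_comm, h1, hpow, ← Finset.prod_inv_distrib, ← Finset.prod_mul_distrib]
  refine Finset.prod_congr rfl fun i _ => ?_
  field_simp

theorem sum_shuffleIncr (n m : ℕ) (σ : Equiv.Perm (Fin n)) :
    ∑ i ∈ Finset.range n, shuffleIncr n m σ i = n * riseDev n σ / m := by
  have h : ∀ N : ℕ, ∑ i ∈ Finset.range N, ((n : ℝ) - rSeq n σ - i) =
      N * (n - rSeq n σ - ((N : ℝ) - 1) / 2) := fun N => by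
    induction N with
    | zero => simp
    | succ N ih => rw [Finset.sum_range_succ, ih]; push_cast; ring
  simp only [shuffleIncr, ← Finset.sum_div, h, riseDev]
  ring

theorem sum_shuffleIncr_sq (n m : ℕ) (σ : Equiv.Perm (Fin n)) :
    ∑ i ∈ Finset.range n, shuffleIncr n m σ i ^ 2 =
      (n * riseDev n σ ^ 2 + n * ((n : ℝ) ^ 2 - 1) / 12) / (m : ℝ) ^ 2 := by
  have h : ∀ (c : ℝ) (N : ℕ), ∑ i ∈ Finset.range N, (c - i) ^ 2 =
      N * (c - ((N : ℝ) - 1) / 2) ^ 2 + N * ((N : ℝ) ^ 2 - 1) / 12 := fun c N => by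
    induction N with
    | zero => simp
    | succ N ih => rw [Finset.sum_range_succ, ih]; push_cast; ring
  simp only [shuffleIncr, div_pow, ← Finset.sum_div, h, riseDev]
  ring

theorem one_add_le_exp {x : ℝ} (h0 : -1 ≤ x) (h8 : x ≤ 8) :
    1 + x ≤ Real.exp (x - x ^ 2 / 16) := by
  set s := Real.sqrt (1 + x) with hs
  have hs0 : 0 ≤ s := Real.sqrt_nonneg _
  have hsq : s ^ 2 = 1 + x := Real.sq_sqrt (by linarith)
  have hs3 : s ≤ 3 := by nlinarith
  have hx : x = s ^ 2 - 1 := by linarith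
  calc 1 + x = s ^ 2 := hsq.symm
    _ ≤ Real.exp (s - 1) ^ 2 := by
      gcongr
      linarith [Real.add_one_le_exp (s - 1)]
    _ = Real.exp (2 * (s - 1)) := by rw [← Real.exp_nat_mul]; norm_num
    _ ≤ Real.exp (x - x ^ 2 / 16) := by
      rw [Real.exp_le_exp, hx]
      nlinarith [mul_nonneg (sq_nonneg (s - 1)) (mul_nonneg (by linarith : 0 ≤ 3 - s)
        (by linarith : 0 ≤ 5 + s))]

theorem exp_le_one_add {x : ℝ} (h : -(1 / 2) ≤ x) : Real.exp (x - 2 * x ^ 2) ≤ 1 + x := by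
  have hpos : 0 < 1 + x := by linarith
  have h1 : (1 + x)⁻¹ ≤ Real.exp (-(x - 2 * x ^ 2)) := by
    refine le_trans ?_ (Real.add_one_le_exp _)
    rw [inv_le_iff_one_le_mul₀ hpos]
    nlinarith [mul_nonneg (sq_nonneg x) (by linarith : 0 ≤ 1 + 2 * x)]
  rw [Real.exp_neg] at h1
  exact (inv_le_inv₀ hpos (Real.exp_pos _)).1 h1

theorem tv_nonneg (n : ℕ) (μ ν : Equiv.Perm (Fin n) → ℝ) : 0 ≤ tv n μ ν := by
  unfold tv; positivity

theorem tv_le_sum_of_sub_le (n : ℕ) (μ ν c : Equiv.Perm (Fin n) → ℝ)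
    (h : ∑ σ, μ σ = ∑ σ, ν σ) (hc : ∀ σ, 0 ≤ c σ) (hle : ∀ σ, ν σ - μ σ ≤ c σ) :
    tv n μ ν ≤ ∑ σ, c σ := by
  have h1 : ∀ σ, |μ σ - ν σ| ≤ 2 * c σ + (μ σ - ν σ) := fun σ => by
    rw [abs_le]; constructor <;> linarith [hc σ, hle σ]
  have h2 := Finset.sum_le_sum fun σ (_ : σ ∈ Finset.univ) => h1 σ
  rw [Finset.sum_add_distrib, Finset.sum_sub_distrib, h, ← Finset.mul_sum] at h2
  unfold tv
  linarith

theorem sum_Us (n : ℕ) : ∑ σ, Us n σ = 1 := by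
  simp [Us, Fintype.card_perm, Nat.factorial_ne_zero]

/-- Shuffles with many packets are close to uniform. -/
theorem tv_Qs_le (n m : ℕ) (hn : n ≠ 0) (hnm : 2 * n ≤ m) {η : ℝ} (hη : 0 < η) :
    tv n (Qs n m) (Us n) ≤
      η + 3 * ((n : ℝ) ^ 3 / m ^ 2) / η + 2 * ((n : ℝ) ^ 3 / m ^ 2) := by
  have hm : m ≠ 0 := by omega
  have hm' : (0 : ℝ) < m := by positivity
  have hF : (0 : ℝ) < n.factorial := by positivity
  set w := (n : ℝ) ^ 3 / m ^ 2 with hw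
  have hw0 : 0 ≤ w := by positivity
  refine (tv_le_sum_of_sub_le n _ _ (fun σ => (n.factorial : ℝ)⁻¹ *
    (η + (n * riseDev n σ / m) ^ 2 / η + 2 * w)) ?_ ?_ ?_).trans ?_
  · rw [sum_Us, sum_Qs n m hm]
  · intro σ; positivity
  · intro σ
    have hr := rSeq_le n hn σ
    have hr1 := rSeq_pos n σ
    have hr' : (rSeq n σ : ℝ) ≤ n := by exact_mod_cast hr
    have hr1' : (1 : ℝ) ≤ rSeq n σ := by exact_mod_cast hr1
    have hnm' : 2 * (n : ℝ) ≤ m := by exact_mod_cast hnm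
    have hx : ∀ i ∈ Finset.range n, |shuffleIncr n m σ i| ≤ n / m := by
      intro i hi
      have hi' : (i : ℝ) + 1 ≤ n := by exact_mod_cast Finset.mem_range.1 hi
      have hi0 : (0 : ℝ) ≤ i := by positivity
      rw [shuffleIncr, abs_div, abs_of_pos hm']
      gcongr
      rw [abs_le]; constructor <;> linarith
    have hhalf : (n : ℝ) / m ≤ 1 / 2 := by
      rw [div_le_div_iff₀ hm' two_pos]; linarith
    have h1 : Real.exp (n * riseDev n σ / m - 2 * w) ≤ n.factorial * Qs n m σ := by
      rw [factorial_mul_Qs n m hm σ (by omega)]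
      calc _ ≤ Real.exp (∑ i ∈ Finset.range n,
            (shuffleIncr n m σ i - 2 * shuffleIncr n m σ i ^ 2)) := by
            rw [Real.exp_le_exp, Finset.sum_sub_distrib, sum_shuffleIncr, ← Finset.mul_sum]
            have : ∑ i ∈ Finset.range n, shuffleIncr n m σ i ^ 2 ≤ w := by
              calc _ ≤ ∑ i ∈ Finset.range n, ((n : ℝ) / m) ^ 2 :=
                    Finset.sum_le_sum fun i hi => sq_le_sq' (neg_le_of_abs_le (hx i hi))
                      (le_of_abs_le (hx i hi))
                _ = w := by simp [hw]; ring
            linarith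
        _ = ∏ i ∈ Finset.range n,
            Real.exp (shuffleIncr n m σ i - 2 * shuffleIncr n m σ i ^ 2) := Real.exp_sum _ _
        _ ≤ _ := Finset.prod_le_prod (fun _ _ => (Real.exp_pos _).le) fun i hi =>
            exp_le_one_add (by linarith [neg_le_of_abs_le (hx i hi)])
    have h2 := Real.add_one_le_exp (n * riseDev n σ / m - 2 * w)
    set y := n * riseDev n σ / m with hy
    have h3 : -y ≤ η + y ^ 2 / η := by
      have : η + y ^ 2 / η + y = ((y + η / 2) ^ 2 + 3 / 4 * η ^ 2) / η := by
        field_simp; ring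
      have h4 : 0 ≤ ((y + η / 2) ^ 2 + 3 / 4 * η ^ 2) / η := by positivity
      linarith
    have h5 : Us n σ - Qs n m σ = (n.factorial : ℝ)⁻¹ * (1 - n.factorial * Qs n m σ) := by
      unfold Us; field_simp
    rw [h5]
    gcongr
    linarith
  · rw [← Finset.mul_sum, Finset.sum_add_distrib, Finset.sum_add_distrib]
    have h6 : ∑ σ, (n * riseDev n σ / m) ^ 2 / η ≤ n.factorial * (3 * w / η) := by
      have : ∀ σ, (n * riseDev n σ / m) ^ 2 / η = (n : ℝ) ^ 2 / m ^ 2 / η * riseDev n σ ^ 2 :=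
        fun σ => by ring
      simp only [this, ← Finset.mul_sum]
      calc _ ≤ (n : ℝ) ^ 2 / m ^ 2 / η * (3 * n * n.factorial) := by
            gcongr; exact sum_riseDev_sq_le n hn
        _ = _ := by rw [hw]; ring
    simp only [Finset.sum_const, Finset.card_univ, Fintype.card_perm, Fintype.card_fin,
      nsmul_eq_mul]
    rw [inv_mul_le_iff₀ hF]
    linarith

/-- Shuffles with few packets give little mass to each permutation with a typical number of
rising sequences. -/
theorem factorial_mul_Qs_le (n m : ℕ) (hn : 2 ≤ n) (hnm : n ≤ 4 * m) (σ : Equiv.Perm (Fin n))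
    (hσ : 512 * m * riseDev n σ ≤ (n : ℝ) ^ 2) :
    n.factorial * Qs n m σ ≤ Real.exp (-((n : ℝ) ^ 3 / (512 * m ^ 2))) := by
  have hm : m ≠ 0 := by omega
  have hm' : (0 : ℝ) < m := by positivity
  have hn' : (2 : ℝ) ≤ n := by exact_mod_cast hn
  have hnm' : (n : ℝ) ≤ 4 * m := by exact_mod_cast hnm
  have hr1' : (1 : ℝ) ≤ rSeq n σ := by exact_mod_cast rSeq_pos n σ
  by_cases hr : rSeq n σ ≤ m
  · have hr' : (rSeq n σ : ℝ) ≤ m := by exact_mod_cast hr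
    have hx : ∀ i ∈ Finset.range n, -1 ≤ shuffleIncr n m σ i ∧ shuffleIncr n m σ i ≤ 8 := by
      intro i hi
      have hi' : (i : ℝ) + 1 ≤ n := by exact_mod_cast Finset.mem_range.1 hi
      have hi0 : (0 : ℝ) ≤ i := by positivity
      rw [shuffleIncr, le_div_iff₀ hm', div_le_iff₀ hm']
      constructor <;> linarith
    rw [factorial_mul_Qs n m hm σ hr]
    calc _ ≤ ∏ i ∈ Finset.range n,
          Real.exp (shuffleIncr n m σ i - shuffleIncr n m σ i ^ 2 / 16) :=
          Finset.prod_le_prod (fun i hi => by linarith [(hx i hi).1]) fun i hi =>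
            one_add_le_exp (hx i hi).1 (hx i hi).2
      _ = Real.exp (n * riseDev n σ / m -
          (n * riseDev n σ ^ 2 + n * ((n : ℝ) ^ 2 - 1) / 12) / (m : ℝ) ^ 2 / 16) := by
          rw [← Real.exp_sum, Finset.sum_sub_distrib, sum_shuffleIncr, ← Finset.sum_div,
            sum_shuffleIncr_sq]
      _ ≤ _ := by
          rw [Real.exp_le_exp]
          have h1 : n * riseDev n σ / m ≤ (n : ℝ) ^ 3 / (512 * m ^ 2) := by
            rw [div_le_div_iff₀ hm' (by positivity)]
            nlinarith [mul_le_mul_of_nonneg_left hσ (by positivity : 0 ≤ (n : ℝ) * m)]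
          have h2 : (n : ℝ) ^ 3 / (256 * m ^ 2) ≤
              (n * riseDev n σ ^ 2 + n * ((n : ℝ) ^ 2 - 1) / 12) / (m : ℝ) ^ 2 / 16 := by
            rw [div_div, div_le_div_iff₀ (by positivity) (by positivity)]
            have h3 : (n : ℝ) ^ 3 * 16 ≤
                256 * (n * riseDev n σ ^ 2 + n * ((n : ℝ) ^ 2 - 1) / 12) := by
              nlinarith [mul_nonneg (by positivity : (0 : ℝ) ≤ n) (sq_nonneg (riseDev n σ)),
                mul_nonneg (by positivity : (0 : ℝ) ≤ n) (by nlinarith : 0 ≤ (n : ℝ) ^ 2 - 4)]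
            nlinarith [mul_le_mul_of_nonneg_right h3 (by positivity : (0 : ℝ) ≤ (m : ℝ) ^ 2)]
          have h4 : (n : ℝ) ^ 3 / (256 * m ^ 2) = 2 * ((n : ℝ) ^ 3 / (512 * m ^ 2)) := by
            field_simp; norm_num
          linarith
  · have : Qs n m σ = 0 := by
      unfold Qs
      rw [Nat.choose_eq_zero_of_lt (by omega)]
      simp
    rw [this, mul_zero]
    exact (Real.exp_pos _).le

theorem tv_le_one (n : ℕ) (μ : Equiv.Perm (Fin n) → ℝ) (h0 : ∀ σ, 0 ≤ μ σ)
    (h1 : ∑ σ, μ σ ≤ 1) : tv n μ (Us n) ≤ 1 := by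
  have h : ∑ σ, |μ σ - Us n σ| ≤ ∑ σ, (μ σ + Us n σ) := Finset.sum_le_sum fun σ _ => by
    have : 0 ≤ Us n σ := by unfold Us; positivity
    rw [abs_le]; constructor <;> linarith [h0 σ]
  rw [Finset.sum_add_distrib, sum_Us] at h
  unfold tv
  linarith

theorem one_sub_le_tv (n : ℕ) (μ : Equiv.Perm (Fin n) → ℝ) (h1 : ∑ σ, μ σ = 1)
    (B : Finset (Equiv.Perm (Fin n))) :
    1 - ∑ σ ∈ Bᶜ, Us n σ - ∑ σ ∈ B, μ σ ≤ tv n μ (Us n) := by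
  have hU := sum_Us n
  rw [← Finset.sum_add_sum_compl B] at hU h1
  have hB : ∑ σ ∈ B, (Us n σ - μ σ) ≤ ∑ σ ∈ B, |μ σ - Us n σ| :=
    Finset.sum_le_sum fun σ _ => by rw [abs_sub_comm]; exact le_abs_self _
  have hC : ∑ σ ∈ Bᶜ, (μ σ - Us n σ) ≤ ∑ σ ∈ Bᶜ, |μ σ - Us n σ| :=
    Finset.sum_le_sum fun σ _ => le_abs_self _
  rw [Finset.sum_sub_distrib] at hB hC
  unfold tv
  rw [← Finset.sum_add_sum_compl B]
  linarith

theorem sum_Us_riseDev_gt_le (n : ℕ) (hn : n ≠ 0) {H : ℝ} (hH : 0 < H)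
    (B : Finset (Equiv.Perm (Fin n))) (hB : ∀ σ ∈ B, H < riseDev n σ) :
    ∑ σ ∈ B, Us n σ ≤ 3 * n / H ^ 2 := by
  have hF : (0 : ℝ) < n.factorial := by positivity
  calc ∑ σ ∈ B, Us n σ ≤ ∑ σ ∈ B, (n.factorial : ℝ)⁻¹ * (riseDev n σ ^ 2 / H ^ 2) := by
        refine Finset.sum_le_sum fun σ hσ => ?_
        have : 1 ≤ riseDev n σ ^ 2 / H ^ 2 := by
          rw [one_le_div (by positivity)]
          exact pow_le_pow_left₀ hH.le (hB σ hσ).le 2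
        simpa [Us] using mul_le_mul_of_nonneg_left this (inv_nonneg.2 hF.le)
    _ ≤ ∑ σ, (n.factorial : ℝ)⁻¹ * (riseDev n σ ^ 2 / H ^ 2) :=
        Finset.sum_le_sum_of_subset_of_nonneg (Finset.subset_univ _) fun σ _ _ => by positivity
    _ = (n.factorial : ℝ)⁻¹ * ((∑ σ, riseDev n σ ^ 2) / H ^ 2) := by
        rw [← Finset.mul_sum, Finset.sum_div]
    _ ≤ (n.factorial : ℝ)⁻¹ * ((3 * n * n.factorial) / H ^ 2) := by
        gcongr; exact sum_riseDev_sq_le n hn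
    _ = _ := by field_simp

theorem sum_Qs_riseDev_le (n m : ℕ) (hn : 2 ≤ n) {L : ℝ} (hL : 0 < L) (hmL : m ≤ L)
    (hnL : n ≤ 128 * L) (B : Finset (Equiv.Perm (Fin n)))
    (hB : ∀ σ ∈ B, riseDev n σ ≤ (n : ℝ) ^ 2 / (512 * L)) :
    ∑ σ ∈ B, Qs n m σ ≤ Real.exp (-((n : ℝ) ^ 3 / (512 * L ^ 2))) := by
  have hF : (0 : ℝ) < n.factorial := by positivity
  have hn' : (2 : ℝ) ≤ n := by exact_mod_cast hn
  set e := Real.exp (-((n : ℝ) ^ 3 / (512 * L ^ 2)))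
  have key : ∀ σ ∈ B, Qs n m σ ≤ (n.factorial : ℝ)⁻¹ * e := by
    intro σ hσ
    have hd := hB σ hσ
    rw [le_div_iff₀ (by positivity)] at hd
    rw [le_inv_mul_iff₀ hF]
    by_cases hnm : n ≤ 4 * m
    · have hm' : (0 : ℝ) < m := by
        have : 0 < m := by omega
        exact_mod_cast this
      refine (factorial_mul_Qs_le n m hn hnm σ ?_).trans ?_
      · rcases le_total 0 (riseDev n σ) with h | h
        · nlinarith [mul_le_mul_of_nonneg_left hmL h]
        · nlinarith [mul_nonneg_of_nonpos_of_nonpos (neg_nonpos.2 hm'.le) h]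
      · rw [Real.exp_le_exp, neg_le_neg_iff]
        gcongr
    · have hnm' : 4 * (m : ℝ) < n := by exact_mod_cast not_le.1 hnm
      have hr : m < rSeq n σ := by
        by_contra hr
        have hr' : (rSeq n σ : ℝ) ≤ m := by exact_mod_cast not_lt.1 hr
        have h1 : (n : ℝ) / 4 < riseDev n σ := by unfold riseDev; linarith
        nlinarith [mul_lt_mul_of_pos_right h1 hL, mul_le_mul_of_nonneg_left hnL
          (by positivity : (0 : ℝ) ≤ n)]
      have : Qs n m σ = 0 := by
        unfold Qs
        rw [Nat.choose_eq_zero_of_lt (by omega)]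
        simp
      rw [this, mul_zero]
      exact (Real.exp_pos _).le
  calc _ ≤ ∑ σ ∈ B, (n.factorial : ℝ)⁻¹ * e := Finset.sum_le_sum key
    _ ≤ ∑ σ : Equiv.Perm (Fin n), (n.factorial : ℝ)⁻¹ * e :=
        Finset.sum_le_sum_of_subset_of_nonneg (Finset.subset_univ _) fun σ _ _ => by positivity
    _ = e := by simp [Fintype.card_perm, Nat.factorial_ne_zero]

open ProbabilityTheory

/-- A sequence of random variables is i.i.d. with the law on `ℕ` given by the weights `p`. -/
structure IsIIDWith (p : ℕ → ℝ) {Ω : Type} [MeasurableSpace Ω] (P : Measure Ω)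
    (X : ℕ → Ω → ℕ) : Prop where
  prob : IsProbabilityMeasure P
  meas : ∀ i, Measurable (X i)
  indep : iIndepFun X P
  integral_comp : ∀ (i : ℕ) (g : ℕ → ℝ) (C : ℝ), (∀ k, |g k| ≤ C) →
    ∫ ω, g (X i ω) ∂P = ∑' k, p k * g k

theorem exists_isIIDWith (p : ℕ → ℝ) (hp0 : ∀ k, 0 ≤ p k) (hpsum : ∑' k, p k = 1) :
    ∃ (Ω : Type) (_ : MeasurableSpace Ω) (P : Measure Ω) (X : ℕ → Ω → ℕ), IsIIDWith p P X := by
  have hs : Summable p := by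
    by_contra h
    rw [tsum_eq_zero_of_not_summable h] at hpsum
    exact zero_ne_one hpsum
  let q : PMF ℕ := ⟨fun k => ENNReal.ofReal (p k), by
    rw [ENNReal.summable.hasSum_iff, ← ENNReal.ofReal_tsum_of_nonneg hp0 hs, hpsum,
      ENNReal.ofReal_one]⟩
  obtain ⟨Ω, mΩ, P, X, hX, hlaw, hind, hP⟩ := exists_iid ℕ q.toMeasure
  refine ⟨Ω, mΩ, P, X, hP, hX, hind, fun i g C hg => ?_⟩
  have hgm : Measurable g := measurable_of_countable g
  rw [← integral_map (φ := X i) (f := g) (hX i).aemeasurable hgm.aestronglyMeasurable,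
    (hlaw i).map_eq, PMF.integral_eq_tsum _ _
      (Integrable.of_bound hgm.aestronglyMeasurable C (Filter.Eventually.of_forall hg))]
  refine tsum_congr fun k => ?_
  rw [smul_eq_mul, show q k = ENNReal.ofReal (p k) from rfl, ENNReal.toReal_ofReal (hp0 k)]

namespace IsIIDWith

variable {p : ℕ → ℝ} {Ω : Type} [MeasurableSpace Ω] {P : Measure Ω} {X : ℕ → Ω → ℕ}

theorem measurable_prod (h : IsIIDWith p P X) (k : ℕ) :
    Measurable fun ω => ∏ i ∈ Finset.range k, X i ω :=
  Finset.measurable_fun_prod _ fun i _ => h.meas i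

theorem integrable_comp (h : IsIIDWith p P X) {M : Ω → ℕ} (hM : Measurable M) (g : ℕ → ℝ)
    (C : ℝ) (hg : ∀ k, |g k| ≤ C) : Integrable (fun ω => g (M ω)) P :=
  have := h.prob
  Integrable.of_bound ((measurable_of_countable g).comp hM).aestronglyMeasurable C
    (Filter.Eventually.of_forall fun _ => hg _)

theorem abs_Qs_le (n m : ℕ) (σ : Equiv.Perm (Fin n)) : |Qs n m σ| ≤ 1 := by
  rw [abs_of_nonneg (Qs_nonneg n m σ)]; exact Qs_le_one n m σ

/-- Convolution powers of a mixed shuffle are mixtures over products of packet numbers. -/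
theorem iterConv_eq_integral (h : IsIIDWith p P X) (n k : ℕ) (σ : Equiv.Perm (Fin n)) :
    iterConv n (Qp n p) k σ = ∫ ω, Qs n (∏ i ∈ Finset.range k, X i ω) σ ∂P := by
  have := h.prob
  induction k generalizing σ with
  | zero => simp [iterConv, Qs_one]
  | succ k ih =>
    have hint : ∀ τ : Equiv.Perm (Fin n), Qp n p (σ * τ⁻¹) * iterConv n (Qp n p) k τ =
        ∫ ω, Qs n (X k ω) (σ * τ⁻¹) * Qs n (∏ i ∈ Finset.range k, X i ω) τ ∂P := by
      intro τ
      have hi0 := (h.indep.indepFun_prod_range_succ h.meas k).symm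
      rw [show ∏ i ∈ Finset.range k, X i = fun ω => ∏ i ∈ Finset.range k, X i ω from
        funext fun ω => Finset.prod_apply _ _ _] at hi0
      have hi := hi0.comp (measurable_of_countable fun m => Qs n m (σ * τ⁻¹))
        (measurable_of_countable fun m => Qs n m τ)
      simp only [Function.comp_def] at hi
      have hmul := hi.integral_fun_mul_eq_mul_integral
        (h.integrable_comp (h.meas k) (fun m => Qs n m (σ * τ⁻¹)) 1
          fun m => abs_Qs_le n m _).aestronglyMeasurable
        (h.integrable_comp (h.measurable_prod k) (fun m => Qs n m τ) 1
          fun m => abs_Qs_le n m _).aestronglyMeasurable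
      rw [hmul, ih, h.integral_comp k (fun m => Qs n m (σ * τ⁻¹)) 1 fun m => abs_Qs_le n m _]
      rfl
    rw [iterConv, convol, Finset.sum_congr rfl fun τ _ => hint τ, ← integral_finsetSum]
    · refine integral_congr_ae (Filter.Eventually.of_forall fun ω => ?_)
      simp only
      rw [Finset.prod_range_succ, mul_comm, ← convol_Qs]
      rfl
    · intro τ _
      refine Integrable.of_bound (((measurable_of_countable
        (fun m => Qs n m (σ * τ⁻¹))).comp (h.meas k)).mul ((measurable_of_countable
        (fun m => Qs n m τ)).comp (h.measurable_prod k))).aestronglyMeasurable 1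
        (Filter.Eventually.of_forall fun ω => ?_)
      rw [Real.norm_eq_abs, abs_mul]
      exact mul_le_one₀ (abs_Qs_le n _ _) (abs_nonneg _) (abs_Qs_le n _ _)

theorem ae_ne_zero (h : IsIIDWith p P X) (hpz : p 0 = 0) : ∀ᵐ ω ∂P, ∀ i, X i ω ≠ 0 := by
  have := h.prob
  rw [ae_all_iff]
  intro i
  have h1 := h.integral_comp i (fun k => if k = 0 then 1 else 0) 1
    fun k => by split_ifs <;> simp
  have h2 : ∑' k, p k * (if k = 0 then (1 : ℝ) else 0) = 0 := by
    rw [tsum_congr (g := fun _ => (0 : ℝ)) fun k => by split_ifs with hk <;> simp [hk, hpz],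
      tsum_zero]
  rw [h2, integral_eq_zero_iff_of_nonneg (fun ω => by positivity)
    (h.integrable_comp (h.meas i) (fun k => if k = 0 then 1 else 0) 1
      fun k => by split_ifs <;> simp)] at h1
  filter_upwards [h1] with ω hω h0
  simp [h0] at hω

/-- Chebyshev's inequality for a sum of bounded functions of the variables. -/
theorem chebyshev (h : IsIIDWith p P X) (g : ℕ → ℝ) (C : ℝ) (hg : ∀ k, |g k| ≤ C) (k : ℕ)
    {d : ℝ} (hd : 0 < d) :
    P.real {ω | d ≤ |∑ i ∈ Finset.range k, g (X i ω) - k * ∑' j, p j * g j|} ≤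
      k * (∑' j, p j * g j ^ 2) / d ^ 2 := by
  have := h.prob
  have hL : ∀ i, MemLp (fun ω => g (X i ω)) 2 P := fun i =>
    MemLp.of_bound ((measurable_of_countable g).comp (h.meas i)).aestronglyMeasurable C
      (Filter.Eventually.of_forall fun _ => hg _)
  have hvar : Var[∑ i ∈ Finset.range k, fun ω => g (X i ω); P] ≤ k * ∑' j, p j * g j ^ 2 := by
    rw [IndepFun.variance_sum (fun i _ => hL i) fun i _ j _ hij =>
      (h.indep.indepFun hij).comp (measurable_of_countable g) (measurable_of_countable g)]
    calc _ ≤ ∑ i ∈ Finset.range k, ∑' j, p j * g j ^ 2 := Finset.sum_le_sum fun i _ => by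
          refine (variance_le_expectation_sq (hL i).aestronglyMeasurable).trans (le_of_eq ?_)
          exact h.integral_comp i (fun j => g j ^ 2) (C ^ 2) fun j => by
            rw [abs_pow]; exact pow_le_pow_left₀ (abs_nonneg _) (hg j) 2
      _ = _ := by simp
  have hmean : P[∑ i ∈ Finset.range k, fun ω => g (X i ω)] = k * ∑' j, p j * g j := by
    simp only [Finset.sum_apply]
    rw [integral_finsetSum _ fun i _ => h.integrable_comp (h.meas i) g C hg,
      Finset.sum_congr rfl fun i _ => h.integral_comp i g C hg]
    simp
  have hch := meas_ge_le_variance_div_sq (memLp_finsetSum' (Finset.range k) fun i _ => hL i) hd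
  rw [hmean] at hch
  simp only [Finset.sum_apply] at hch
  calc _ ≤ Var[∑ i ∈ Finset.range k, fun ω => g (X i ω); P] / d ^ 2 :=
        ENNReal.toReal_le_of_le_ofReal (div_nonneg (variance_nonneg _ _) (sq_nonneg _)) hch
    _ ≤ _ := by gcongr

theorem integral_le_measure_add (h : IsIIDWith p P X) {M : Ω → ℕ} (hM : Measurable M)
    (φ : ℕ → ℝ) (h0 : ∀ m, 0 ≤ φ m) (h1 : ∀ m, φ m ≤ 1) (S : Set ℕ) {δ : ℝ} (hδ : 0 ≤ δ)
    (hS : ∀ m ∉ S, φ m ≤ δ) : ∫ ω, φ (M ω) ∂P ≤ P.real (M ⁻¹' S) + δ := by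
  have := h.prob
  have hMS : MeasurableSet (M ⁻¹' S) := hM (MeasurableSet.of_discrete)
  calc ∫ ω, φ (M ω) ∂P ≤ ∫ ω, ((M ⁻¹' S).indicator 1 ω + δ) ∂P := by
        refine integral_mono (h.integrable_comp hM φ 1 fun m => by
          rw [abs_of_nonneg (h0 m)]; exact h1 m) ?_ fun ω => ?_
        · exact ((integrable_const (1 : ℝ)).indicator hMS).add (integrable_const δ)
        · by_cases hω : ω ∈ M ⁻¹' S
          · simp only [Set.indicator_of_mem hω, Pi.one_apply]
            linarith [h1 (M ω)]
          · simp only [Set.indicator_of_notMem hω]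
            linarith [hS (M ω) hω]
    _ = P.real (M ⁻¹' S) + δ := by
        rw [integral_add (f := (M ⁻¹' S).indicator 1)
          ((integrable_const (1 : ℝ)).indicator hMS) (integrable_const δ),
          integral_indicator_one hMS]
        simp

theorem sum_iterConv (h : IsIIDWith p P X) (hpz : p 0 = 0) (n k : ℕ) :
    ∑ σ, iterConv n (Qp n p) k σ = 1 := by
  have := h.prob
  simp only [h.iterConv_eq_integral]
  rw [← integral_finsetSum _ fun σ _ => h.integrable_comp (h.measurable_prod k)
    (fun m => Qs n m σ) 1 fun m => abs_Qs_le n m σ]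
  rw [integral_congr_ae (g := fun _ => (1 : ℝ))]
  · simp
  · filter_upwards [h.ae_ne_zero hpz] with ω hω
    exact sum_Qs n _ (Finset.prod_ne_zero_iff.2 fun i _ => hω i)

theorem iterConv_nonneg (h : IsIIDWith p P X) (n k : ℕ) (σ : Equiv.Perm (Fin n)) :
    0 ≤ iterConv n (Qp n p) k σ := by
  rw [h.iterConv_eq_integral]
  exact integral_nonneg fun ω => Qs_nonneg n _ σ

theorem tv_iterConv_le (h : IsIIDWith p P X) (n k : ℕ) :
    tv n (iterConv n (Qp n p) k) (Us n) ≤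
      ∫ ω, tv n (Qs n (∏ i ∈ Finset.range k, X i ω)) (Us n) ∂P := by
  have := h.prob
  have hi : ∀ σ, Integrable (fun ω => Qs n (∏ i ∈ Finset.range k, X i ω) σ - Us n σ) P :=
    fun σ => (h.integrable_comp (h.measurable_prod k) (fun m => Qs n m σ) 1
      fun m => abs_Qs_le n m σ).sub (integrable_const _)
  unfold tv
  rw [integral_const_mul, integral_finsetSum _ fun σ _ => (hi σ).abs]
  gcongr with σ
  rw [h.iterConv_eq_integral]
  have : ∫ ω, Qs n (∏ i ∈ Finset.range k, X i ω) σ ∂P - Us n σ =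
      ∫ ω, (Qs n (∏ i ∈ Finset.range k, X i ω) σ - Us n σ) ∂P := by
    rw [integral_sub (h.integrable_comp (h.measurable_prod k) (fun m => Qs n m σ) 1
      fun m => abs_Qs_le n m σ) (integrable_const _)]
    simp
  rw [this]
  exact abs_integral_le_integral_abs

end IsIIDWith

/-- The truncated logarithm. -/
def truncLog (a : ℝ) (k : ℕ) : ℝ := if Real.log k ≤ a then Real.log k else 0

/-- The square of the logarithm capped at `a`. -/
def capLogSq (a : ℝ) (k : ℕ) : ℝ := if Real.log k ≤ a then Real.log k ^ 2 else a ^ 2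

theorem truncLog_nonneg (a : ℝ) (k : ℕ) : 0 ≤ truncLog a k := by
  unfold truncLog
  split_ifs
  · exact Real.log_natCast_nonneg k
  · exact le_rfl

theorem truncLog_le_log (a : ℝ) (k : ℕ) : truncLog a k ≤ Real.log k := by
  unfold truncLog
  split_ifs
  · exact le_rfl
  · exact Real.log_natCast_nonneg k

theorem abs_truncLog_le {a : ℝ} (ha : 0 < a) (k : ℕ) : |truncLog a k| ≤ a := by
  rw [abs_of_nonneg (truncLog_nonneg a k)]
  unfold truncLog
  split_ifs with h
  · exact h
  · exact ha.le

theorem capLogSq_nonneg (a : ℝ) (k : ℕ) : 0 ≤ capLogSq a k := by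
  unfold capLogSq; split_ifs <;> positivity

theorem abs_capLogSq_le (a : ℝ) (k : ℕ) : |capLogSq a k| ≤ a ^ 2 := by
  rw [abs_of_nonneg (capLogSq_nonneg a k)]
  unfold capLogSq
  split_ifs with h
  · exact pow_le_pow_left₀ (Real.log_natCast_nonneg k) h 2
  · exact le_rfl

theorem truncLog_sq_le (a : ℝ) (k : ℕ) : truncLog a k ^ 2 ≤ capLogSq a k := by
  unfold truncLog capLogSq; split_ifs
  · exact le_rfl
  · simpa using sq_nonneg a

namespace IsIIDWith

variable {p : ℕ → ℝ} {Ω : Type} [MeasurableSpace Ω] {P : Measure Ω} {X : ℕ → Ω → ℕ}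

theorem chebyshev_truncLog (h : IsIIDWith p P X) {a : ℝ} (ha : 0 < a) (k : ℕ)
    {d : ℝ} (hd : 0 < d) :
    P.real {ω | d ≤ |∑ i ∈ Finset.range k, truncLog a (X i ω) - k * ∑' j, p j * truncLog a j|} ≤
      k * (∑' j, p j * capLogSq a j) / d ^ 2 := by
  have := h.prob
  refine (h.chebyshev (truncLog a) a (abs_truncLog_le ha) k hd).trans ?_
  have hsq : ∀ j, |truncLog a j ^ 2| ≤ a ^ 2 := fun j => by
    rw [abs_pow]; exact pow_le_pow_left₀ (abs_nonneg _) (abs_truncLog_le ha j) 2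
  have : ∑' j, p j * truncLog a j ^ 2 ≤ ∑' j, p j * capLogSq a j := by
    rw [← h.integral_comp 0 (fun j => truncLog a j ^ 2) _ hsq,
      ← h.integral_comp 0 (capLogSq a) _ (abs_capLogSq_le a)]
    exact integral_mono (h.integrable_comp (h.meas 0) (fun j => truncLog a j ^ 2) _ hsq)
      (h.integrable_comp (h.meas 0) (capLogSq a) _ (abs_capLogSq_le a))
      fun ω => truncLog_sq_le a _
  gcongr

theorem measure_log_gt_le (h : IsIIDWith p P X) {a : ℝ} (ha : 0 < a) (i : ℕ) :
    P.real {ω | a < Real.log (X i ω)} ≤ (∑' j, p j * capLogSq a j) / a ^ 2 := by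
  have := h.prob
  have hm : MeasurableSet {ω | a < Real.log (X i ω)} :=
    h.meas i (MeasurableSet.of_discrete (s := {j : ℕ | a < Real.log j}))
  rw [le_div_iff₀ (by positivity), ← h.integral_comp i (capLogSq a) _ (abs_capLogSq_le a),
    ← integral_indicator_one hm, ← integral_mul_const]
  refine integral_mono (((integrable_const (1 : ℝ)).indicator hm).mul_const _)
    (h.integrable_comp (h.meas i) (capLogSq a) _ (abs_capLogSq_le a)) fun ω => ?_
  by_cases hω : a < Real.log (X i ω)
  · simp [Set.indicator, capLogSq, hω, not_le.2 hω]
  · simpa [Set.indicator, hω] using capLogSq_nonneg a (X i ω)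

theorem log_prod_natCast (k : ℕ) (x : ℕ → ℕ) (hx : ∀ i, x i ≠ 0) :
    Real.log ((∏ i ∈ Finset.range k, x i : ℕ) : ℝ) =
      ∑ i ∈ Finset.range k, Real.log (x i) := by
  rw [Nat.cast_prod, Real.log_prod fun i _ => by exact_mod_cast hx i]

/-- If the truncated mean exceeds `l` by `d`, then the product is rarely below `exp l`. -/
theorem measure_prod_lt_le (h : IsIIDWith p P X) (hpz : p 0 = 0) {a : ℝ} (ha : 0 < a) (k : ℕ)
    {d l : ℝ} (hd : 0 < d) (hl : l + d ≤ k * ∑' j, p j * truncLog a j) :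
    P.real {ω | ((∏ i ∈ Finset.range k, X i ω : ℕ) : ℝ) < Real.exp l} ≤
      k * (∑' j, p j * capLogSq a j) / d ^ 2 := by
  have := h.prob
  refine le_trans (ENNReal.toReal_mono (measure_ne_top _ _) (measure_mono_ae ?_))
    (h.chebyshev_truncLog ha k hd)
  filter_upwards [h.ae_ne_zero hpz] with ω hω hlt
  have hlt' : ((∏ i ∈ Finset.range k, X i ω : ℕ) : ℝ) < Real.exp l := hlt
  have hpos : (0 : ℝ) < ((∏ i ∈ Finset.range k, X i ω : ℕ) : ℝ) := by
    exact_mod_cast Nat.pos_of_ne_zero (Finset.prod_ne_zero_iff.2 fun i _ => hω i)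
  rw [← Real.log_lt_iff_lt_exp hpos, log_prod_natCast k (fun i => X i ω) hω] at hlt'
  have hs : ∑ i ∈ Finset.range k, truncLog a (X i ω) ≤
      ∑ i ∈ Finset.range k, Real.log (X i ω) :=
    Finset.sum_le_sum fun i _ => truncLog_le_log a _
  change d ≤ |_|
  rw [abs_sub_comm]
  exact le_trans (by linarith) (le_abs_self _)

/-- If the truncated mean is below `l` by `d`, then the product rarely exceeds `exp l`. -/
theorem measure_lt_prod_le (h : IsIIDWith p P X) (hpz : p 0 = 0) {a : ℝ} (ha : 0 < a) (k : ℕ)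
    {d l : ℝ} (hd : 0 < d) (hl : k * ∑' j, p j * truncLog a j + d ≤ l) :
    P.real {ω | Real.exp l < ((∏ i ∈ Finset.range k, X i ω : ℕ) : ℝ)} ≤
      k * (∑' j, p j * capLogSq a j) / d ^ 2 + k * ((∑' j, p j * capLogSq a j) / a ^ 2) := by
  have := h.prob
  have hsub : P.real {ω | Real.exp l < ((∏ i ∈ Finset.range k, X i ω : ℕ) : ℝ)} ≤
      P.real ({ω | d ≤ |∑ i ∈ Finset.range k, truncLog a (X i ω) -
        k * ∑' j, p j * truncLog a j|} ∪
        ⋃ i ∈ Finset.range k, {ω | a < Real.log (X i ω)}) := by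
    refine ENNReal.toReal_mono (measure_ne_top _ _) (measure_mono_ae ?_)
    filter_upwards [h.ae_ne_zero hpz] with ω hω hlt
    have hlt' : Real.exp l < ((∏ i ∈ Finset.range k, X i ω : ℕ) : ℝ) := hlt
    have hpos : (0 : ℝ) < ((∏ i ∈ Finset.range k, X i ω : ℕ) : ℝ) := (Real.exp_pos _).trans hlt'
    rw [← Real.lt_log_iff_exp_lt hpos, log_prod_natCast k (fun i => X i ω) hω] at hlt'
    by_cases hex : ∃ i ∈ Finset.range k, a < Real.log (X i ω)
    · obtain ⟨i, hi, hi'⟩ := hex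
      exact Or.inr (Set.mem_biUnion hi hi')
    · push Not at hex
      refine Or.inl ?_
      have hs : ∑ i ∈ Finset.range k, truncLog a (X i ω) =
          ∑ i ∈ Finset.range k, Real.log (X i ω) :=
        Finset.sum_congr rfl fun i hi => if_pos (hex i hi)
      change d ≤ |_|
      exact le_trans (by linarith) (le_abs_self _)
  refine hsub.trans ((measureReal_union_le _ _).trans
    (add_le_add (h.chebyshev_truncLog ha k hd) ?_))
  refine (measureReal_biUnion_finset_le _ _).trans
    ((Finset.sum_le_sum fun i _ => h.measure_log_gt_le ha i).trans (le_of_eq ?_))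
  simp

end IsIIDWith

/-- Quantitative convergence after the cutoff time. -/
theorem tv_iterConv_upper (n : ℕ) (hn : 4 ≤ n) (p : ℕ → ℝ) (hp0 : ∀ k, 0 ≤ p k)
    (hpz : p 0 = 0) (hpsum : ∑' k, p k = 1) {a : ℝ} (ha : 0 < a) {y z : ℝ}
    (hy : y = ∑' k, p k * truncLog a k) (hz : z = ∑' k, p k * capLogSq a k) (hy0 : 0 < y)
    {ε : ℝ} (hε : 0 < ε) (hε1 : ε < 1) (k : ℕ)
    (hk : (1 + ε) * (3 * Real.log n / (2 * y)) < k) :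
    tv n (iterConv n (Qp n p) k) (Us n) ≤
      6 / ε ^ 2 * ((a / Real.log n) ^ 2 * (Real.log n * z / (a ^ 2 * y))) +
        6 * Real.exp (-(ε / 2 * Real.log n)) := by
  obtain ⟨Ω, _, P, X, h⟩ := exists_isIIDWith p hp0 hpsum
  have hn' : (4 : ℝ) ≤ n := by exact_mod_cast hn
  set l := Real.log n with hl
  have hl0 : 0 < l := Real.log_pos (by linarith)
  have hnl : (n : ℝ) = Real.exp l := (Real.exp_log (by linarith)).symm
  have hz0 : 0 ≤ z := hz ▸ tsum_nonneg fun j => mul_nonneg (hp0 j) (capLogSq_nonneg a j)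
  have hk' : (1 + ε) * (3 / 2 * l) < k * y := by
    rw [show (1 + ε) * (3 * l / (2 * y)) = (1 + ε) * (3 / 2 * l) / y by field_simp,
      div_lt_iff₀ hy0] at hk
    exact hk
  have hky : 0 < k * y := lt_trans (by positivity) hk'
  have hk0 : (0 : ℝ) < k := pos_of_mul_pos_left hky hy0.le
  have hP := h.measure_prod_lt_le hpz ha k (d := k * y * (ε / 3)) (l := (3 / 2 + ε / 2) * l)
    (by positivity) (by
      rw [← hy]
      nlinarith [mul_le_mul_of_nonneg_right hk'.le (by linarith : 0 ≤ 1 - ε / 3),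
        mul_nonneg (mul_pos hε hl0).le (by linarith : 0 ≤ 1 - ε)])
  rw [← hz] at hP
  have hP' : k * z / (k * y * (ε / 3)) ^ 2 ≤ 6 / ε ^ 2 * ((a / l) ^ 2 * (l * z / (a ^ 2 * y))) := by
    have e1 : k * z / (k * y * (ε / 3)) ^ 2 = 9 * z / (ε ^ 2 * y) * (1 / (k * y)) := by
      field_simp; norm_num
    have e2 : 6 / ε ^ 2 * ((a / l) ^ 2 * (l * z / (a ^ 2 * y))) =
        9 * z / (ε ^ 2 * y) * (1 / (3 / 2 * l)) := by
      field_simp; ring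
    rw [e1, e2]
    exact mul_le_mul_of_nonneg_left
      (one_div_le_one_div_of_le (by positivity) (by nlinarith [mul_pos hε hl0])) (by positivity)
  have hint := h.integral_le_measure_add (h.measurable_prod k)
    (fun m => tv n (Qs n m) (Us n)) (fun m => tv_nonneg n _ _)
    (fun m => tv_le_one n _ (Qs_nonneg n m) (sum_Qs_le n m))
    {m | (m : ℝ) < Real.exp ((3 / 2 + ε / 2) * l)} (δ := 6 * Real.exp (-(ε / 2 * l)))
    (by positivity) fun m hm => ?_
  · exact (h.tv_iterConv_le n k).trans (hint.trans (by gcongr; exact hP.trans hP'))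
  · have hm' : Real.exp ((3 / 2 + ε / 2) * l) ≤ m := not_lt.1 hm
    have hm0 : (0 : ℝ) < m := (Real.exp_pos _).trans_le hm'
    set b := Real.exp (-(ε / 2 * l)) with hb
    have hb0 : 0 < b := Real.exp_pos _
    have hb1 : b ≤ 1 := Real.exp_le_one_iff.2 (by nlinarith)
    have hw : (n : ℝ) ^ 3 / m ^ 2 ≤ b ^ 2 := by
      rw [div_le_iff₀ (by positivity)]
      calc (n : ℝ) ^ 3 = b ^ 2 * Real.exp ((3 / 2 + ε / 2) * l) ^ 2 := by
            rw [hnl, hb, ← Real.exp_nat_mul, ← Real.exp_nat_mul, ← Real.exp_nat_mul,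
              ← Real.exp_add]
            congr 1
            push_cast
            ring
        _ ≤ _ := by gcongr
    have h2n : 2 * n ≤ m := by
      have h1 : (n : ℝ) ^ 3 ≤ m ^ 2 := by
        rw [div_le_iff₀ (by positivity)] at hw
        nlinarith [mul_le_mul_of_nonneg_right (show b ^ 2 ≤ 1 by nlinarith)
          (by positivity : (0 : ℝ) ≤ (m : ℝ) ^ 2)]
      have h2 : (2 * (n : ℝ)) ^ 2 ≤ m ^ 2 := by
        nlinarith [mul_le_mul_of_nonneg_right hn' (by positivity : (0 : ℝ) ≤ (n : ℝ) ^ 2)]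
      exact_mod_cast le_of_sq_le_sq h2 hm0.le
    calc _ ≤ b + 3 * ((n : ℝ) ^ 3 / m ^ 2) / b + 2 * ((n : ℝ) ^ 3 / m ^ 2) :=
          tv_Qs_le n m (by omega) h2n hb0
      _ ≤ b + 3 * b ^ 2 / b + 2 * b ^ 2 := by gcongr
      _ = 4 * b + 2 * b ^ 2 := by field_simp; ring
      _ ≤ 6 * b := by nlinarith

/-- Quantitative distance from uniformity before the cutoff time. -/
theorem tv_iterConv_lower (n : ℕ) (hn : 2 ≤ n) (p : ℕ → ℝ) (hp0 : ∀ k, 0 ≤ p k)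
    (hpz : p 0 = 0) (hpsum : ∑' k, p k = 1) {a : ℝ} (ha : 0 < a) {y z : ℝ}
    (hy : y = ∑' k, p k * truncLog a k) (hz : z = ∑' k, p k * capLogSq a k) (hy0 : 0 < y)
    {ε : ℝ} (hε : 0 < ε) (hε1 : ε < 1) (k : ℕ)
    (hk : (k : ℝ) < (1 - ε) * (3 * Real.log n / (2 * y))) :
    1 - 786432 * Real.exp (-(ε / 2 * Real.log n)) -
      (3 / (2 * ε ^ 2) * ((a / Real.log n) ^ 2 * (Real.log n * z / (a ^ 2 * y))) +
        3 / 2 * (Real.log n * z / (a ^ 2 * y)) +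
        Real.exp (-(Real.exp (ε / 2 * Real.log n) / 512))) ≤
      tv n (iterConv n (Qp n p) k) (Us n) := by
  obtain ⟨Ω, _, P, X, h⟩ := exists_isIIDWith p hp0 hpsum
  have := h.prob
  have hn' : (2 : ℝ) ≤ n := by exact_mod_cast hn
  set l := Real.log n with hl
  have hl0 : 0 < l := Real.log_pos (by linarith)
  have hnl : (n : ℝ) = Real.exp l := (Real.exp_log (by linarith)).symm
  have hz0 : 0 ≤ z := hz ▸ tsum_nonneg fun j => mul_nonneg (hp0 j) (capLogSq_nonneg a j)
  have hk' : k * y < (1 - ε) * (3 / 2 * l) := by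
    rw [show (1 - ε) * (3 * l / (2 * y)) = (1 - ε) * (3 / 2 * l) / y by field_simp,
      lt_div_iff₀ hy0] at hk
    exact hk
  have hkle : (k : ℝ) ≤ 3 / 2 * l / y := by
    rw [le_div_iff₀ hy0]; nlinarith
  have hP := h.measure_lt_prod_le hpz ha k (d := ε * l) (l := (3 / 2 - ε / 4) * l)
    (by positivity) (by rw [← hy]; nlinarith)
  rw [← hz] at hP
  have hP' : k * z / (ε * l) ^ 2 + k * (z / a ^ 2) ≤
      3 / (2 * ε ^ 2) * ((a / l) ^ 2 * (l * z / (a ^ 2 * y))) +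
        3 / 2 * (l * z / (a ^ 2 * y)) := by
    have e1 : 3 / (2 * ε ^ 2) * ((a / l) ^ 2 * (l * z / (a ^ 2 * y))) =
        (3 / 2 * l / y) * z / (ε * l) ^ 2 := by field_simp
    have e2 : 3 / 2 * (l * z / (a ^ 2 * y)) = (3 / 2 * l / y) * (z / a ^ 2) := by field_simp
    rw [e1, e2]
    gcongr
  set L := Real.exp ((3 / 2 - ε / 4) * l) with hL
  have hL0 : 0 < L := Real.exp_pos _
  have hnL : (n : ℝ) ≤ L := by
    rw [hnl, hL, Real.exp_le_exp]; nlinarith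
  have hv : (n : ℝ) ^ 3 / L ^ 2 = Real.exp (ε / 2 * l) := by
    rw [hnl, hL, ← Real.exp_nat_mul, ← Real.exp_nat_mul, ← Real.exp_sub]
    congr 1
    push_cast
    ring
  set B := (Finset.univ : Finset (Equiv.Perm (Fin n))).filter
    fun σ => riseDev n σ ≤ (n : ℝ) ^ 2 / (512 * L) with hB
  have hU : ∑ σ ∈ Bᶜ, Us n σ ≤ 786432 * Real.exp (-(ε / 2 * l)) := by
    refine (sum_Us_riseDev_gt_le n (by omega) (H := (n : ℝ) ^ 2 / (512 * L)) (by positivity) Bᶜ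
      fun σ hσ => ?_).trans (le_of_eq ?_)
    · simpa [hB] using hσ
    · rw [Real.exp_neg, ← hv]
      field_simp
      norm_num
  have hQ : ∑ σ ∈ B, iterConv n (Qp n p) k σ ≤
      P.real {ω | L < ((∏ i ∈ Finset.range k, X i ω : ℕ) : ℝ)} +
        Real.exp (-(Real.exp (ε / 2 * l) / 512)) := by
    simp only [h.iterConv_eq_integral]
    rw [← integral_finsetSum _ fun σ _ => h.integrable_comp (h.measurable_prod k)
      (fun m => Qs n m σ) 1 fun m => IsIIDWith.abs_Qs_le n m σ]
    refine h.integral_le_measure_add (h.measurable_prod k) (fun m => ∑ σ ∈ B, Qs n m σ)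
      (fun m => Finset.sum_nonneg fun σ _ => Qs_nonneg n m σ)
      (fun m => (Finset.sum_le_sum_of_subset_of_nonneg (Finset.subset_univ B)
        fun σ _ _ => Qs_nonneg n m σ).trans (sum_Qs_le n m))
      {m | L < m} (Real.exp_pos _).le fun m hm => ?_
    have hmL : (m : ℝ) ≤ L := not_lt.1 hm
    refine (sum_Qs_riseDev_le n m hn hL0 hmL (by linarith) B
      fun σ hσ => (Finset.mem_filter.1 hσ).2).trans (le_of_eq ?_)
    rw [← hv]
    congr 2
    field_simp
  have := one_sub_le_tv n _ (h.sum_iterConv hpz n k) B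
  linarith

/-- Cutoff for `p_n`-shuffles under a truncated first/second moment condition, with
critical time `t_n = 3 log n / (2 E[Y_n])` where `Y_n = (log X_n)·1{log X_n ≤ a_n}`. -/
theorem pn_shuffle_cutoff_truncated (p : ℕ → ℕ → ℝ) (hp0 : ∀ n k, 0 ≤ p n k)
    (hpz : ∀ n, p n 0 = 0) (hpsum : ∀ n, ∑' k : ℕ, p n k = 1)
    (hEpos : ∀ n, 0 < ∑' k : ℕ, ENNReal.ofReal (p n k * Real.log k))
    (a : ℕ → ℝ) (hapos : ∀ n, 0 < a n)
    (haTop : Filter.Tendsto a Filter.atTop Filter.atTop)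
    (haO : (fun n : ℕ => a n) =O[Filter.atTop] fun n : ℕ => Real.log n)
    (EY EZ2 : ℕ → ℝ)
    (hEY : ∀ n, EY n = ∑' k : ℕ, p n k * (if Real.log k ≤ a n then Real.log k else 0))
    (hEZ2 : ∀ n, EZ2 n = ∑' k : ℕ, p n k *
      (if Real.log k ≤ a n then (Real.log k) ^ 2 else (a n) ^ 2))
    (h1 : Filter.Tendsto (fun n : ℕ => Real.log n * EZ2 n / ((a n) ^ 2 * EY n))
      Filter.atTop (nhds 0))
    (h2 : Filter.Tendsto (fun n : ℕ => Real.log n / EY n) Filter.atTop Filter.atTop)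
    (t : ℕ → ℝ) (ht : ∀ n, t n = 3 * Real.log n / (2 * EY n))
    (ε : ℝ) (hε : ε ∈ Set.Ioo (0 : ℝ) 1) :
    (∀ k : ℕ → ℕ, (∀ n : ℕ, (1 + ε) * t n < (k n : ℝ)) →
      Filter.Tendsto (fun n => tv n (iterConv n (Qp n (p n)) (k n)) (Us n))
        Filter.atTop (nhds 0)) ∧
    (∀ k : ℕ → ℕ, (∀ n : ℕ, 2 ≤ n → (k n : ℝ) < (1 - ε) * t n) →
      Filter.Tendsto (fun n => tv n (iterConv n (Qp n (p n)) (k n)) (Us n))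
        Filter.atTop (nhds 1)) := by
  obtain ⟨hε0, hε1⟩ := hε
  have hlog : Filter.Tendsto (fun n : ℕ => Real.log n) Filter.atTop Filter.atTop :=
    Real.tendsto_log_atTop.comp tendsto_natCast_atTop_atTop
  have hEYpos : ∀ᶠ n : ℕ in Filter.atTop, 0 < EY n := by
    filter_upwards [h2.eventually_gt_atTop 0, hlog.eventually_gt_atTop 0] with n hn hl
    exact (div_pos_iff_of_pos_left hl).1 hn
  have hratio : Filter.Tendsto (fun n : ℕ => (a n / Real.log n) ^ 2 *
      (Real.log n * EZ2 n / ((a n) ^ 2 * EY n))) Filter.atTop (nhds 0) := by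
    have hb : (fun n : ℕ => (a n / Real.log n) ^ 2) =O[Filter.atTop] fun _ => (1 : ℝ) := by
      have h := (haO.mul (Asymptotics.isBigO_refl
        (fun n : ℕ => (Real.log n)⁻¹) Filter.atTop)).pow 2
      refine h.trans (Asymptotics.IsBigO.of_bound 1 (Filter.Eventually.of_forall fun n => ?_))
      rcases eq_or_ne (Real.log n) 0 with h0 | h0 <;> simp [h0]
    have h := hb.mul_isLittleO ((Asymptotics.isLittleO_one_iff ℝ).2 h1)
    simpa using h
  have hexp : Filter.Tendsto (fun n : ℕ => Real.exp (-(ε / 2 * Real.log n)))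
      Filter.atTop (nhds 0) :=
    Real.tendsto_exp_neg_atTop_nhds_zero.comp (hlog.const_mul_atTop (by positivity))
  constructor
  · intro k hk
    refine squeeze_zero' (Filter.Eventually.of_forall fun n => tv_nonneg n _ _) ?_
      (by simpa using (hratio.const_mul (6 / ε ^ 2)).add (hexp.const_mul 6))
    filter_upwards [hEYpos, Filter.eventually_ge_atTop 4] with n hy hn
    exact tv_iterConv_upper n hn (p n) (hp0 n) (hpz n) (hpsum n) (hapos n) (hEY n) (hEZ2 n) hy
      hε0 hε1 (k n) (by rw [← ht n]; exact hk n)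
  · intro k hk
    have hexp2 : Filter.Tendsto (fun n : ℕ => Real.exp (-(Real.exp (ε / 2 * Real.log n) / 512)))
        Filter.atTop (nhds 0) :=
      Real.tendsto_exp_neg_atTop_nhds_zero.comp ((Real.tendsto_exp_atTop.comp
        (hlog.const_mul_atTop (by positivity : 0 < ε / 2))).atTop_div_const (by norm_num))
    have hlow : Filter.Tendsto (fun n : ℕ => 1 - 786432 * Real.exp (-(ε / 2 * Real.log n)) -
        (3 / (2 * ε ^ 2) * ((a n / Real.log n) ^ 2 *
          (Real.log n * EZ2 n / ((a n) ^ 2 * EY n))) +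
          3 / 2 * (Real.log n * EZ2 n / ((a n) ^ 2 * EY n)) +
          Real.exp (-(Real.exp (ε / 2 * Real.log n) / 512)))) Filter.atTop (nhds 1) := by
      simpa using (((hexp.const_mul 786432).const_sub 1).sub
        (((hratio.const_mul (3 / (2 * ε ^ 2))).add (h1.const_mul (3 / 2))).add hexp2))
    refine tendsto_of_tendsto_of_tendsto_of_le_of_le' hlow tendsto_const_nhds ?_
      (Filter.Eventually.of_forall fun n => ?_)
    · filter_upwards [hEYpos, Filter.eventually_ge_atTop 2] with n hy hn
      exact tv_iterConv_lower n hn (p n) (hp0 n) (hpz n) (hpsum n) (hapos n) (hEY n) (hEZ2 n) hy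
        hε0 hε1 (k n) (by rw [← ht n]; exact hk n hn)
    · obtain ⟨Ω, _, P, X, h⟩ := exists_isIIDWith (p n) (hp0 n) (hpsum n)
      exact tv_le_one n _ (h.iterConv_nonneg n (k n)) (h.sum_iterConv (hpz n) n (k n)).le
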